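/- Let M/K be a finite Galois extension with Galois group isomorphic to (ℤ/pℤ)^h. If t is an upper ramification jump of M/K, then there exists an intermediate field L with K ⊆ L ⊆ M, [L : K] = p, such that the extension L/K has upper ramification jump equal to t. -/

import Mathlib

noncomputable section

open scoped Classical

namespace PaperRam

/-- An additive `ℤ ∪ {∞}`-valued valuation on a field is *normalized* if it is
surjective onto `ℤ`. -/
def IsNormalized {F : Type*} [Field F] (v : AddValuation F (WithTop ℤ)) : Prop :=
  ∀ n : ℤ, ∃ x : F, v x = (n : WithTop ℤ)

/-- The normalized valuation `vF` of `F` extends the normalized valuation `vK` of `K`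
with ramification index `e`, i.e. `vF(x) = e · vK(x)` for all `x ∈ K`. -/
def Extends {K F : Type*} [Field K] [Field F] [Algebra K F]
    (vK : AddValuation K (WithTop ℤ)) (vF : AddValuation F (WithTop ℤ)) (e : ℕ) : Prop :=
  0 < e ∧ ∀ x : K, vF (algebraMap K F x) = e • vK x

/-- `v` is the normalized valuation of the `p`-adic field `K`, with (absolute)
ramification index `eK` over `ℚ_p`. -/
def IsPadicValuation (p : ℕ) [Fact p.Prime] {K : Type*} [Field K] [Algebra ℚ_[p] K]
    (v : AddValuation K (WithTop ℤ)) (eK : ℕ) : Prop :=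
  IsNormalized v ∧ 0 < eK ∧
    ∀ x : ℚ_[p], x ≠ 0 → v (algebraMap ℚ_[p] K x) = ((eK * x.valuation : ℤ) : WithTop ℤ)

/-- The valuation `v` of `F` is invariant under all `K`-algebra automorphisms of `F`. -/
def GalInvariant (K : Type*) {F : Type*} [Field K] [Field F] [Algebra K F]
    (v : AddValuation F (WithTop ℤ)) : Prop :=
  ∀ (σ : F ≃ₐ[K] F) (x : F), v (σ x) = v x

variable {K F : Type*} [Field K] [Field F] [Algebra K F]

/-- The lower-numbering ramification subgroup `G_i` of `Gal(F/K)`: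
`σ ∈ G_i ↔ v(σ x − x) ≥ i + 1` for all `x` in the valuation ring of `F`. -/
def lowerRG (v : AddValuation F (WithTop ℤ)) (hv : GalInvariant K v) (i : ℤ) :
    Subgroup (F ≃ₐ[K] F) where
  carrier := {σ | ∀ x : F, 0 ≤ v x → ((i + 1 : ℤ) : WithTop ℤ) ≤ v (σ x - x)}
  one_mem' := by
    intro x _
    simp
  mul_mem' := by
    intro a b ha hb x hx
    have h1 : ((i + 1 : ℤ) : WithTop ℤ) ≤ v (a (b x) - b x) :=
      ha (b x) (by rw [hv b x]; exact hx)
    have h2 := hb x hx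
    have hrw : (a * b) x - x = (a (b x) - b x) + (b x - x) := by
      rw [AlgEquiv.mul_apply]; ring
    rw [hrw]
    exact v.map_le_add h1 h2
  inv_mem' := by
    intro a ha x hx
    have hda : a (a⁻¹ x - x) = x - a x := by
      rw [map_sub]
      congr 1
      exact a.apply_symm_apply x
    have : v (a⁻¹ x - x) = v (a x - x) := by
      rw [← hv a (a⁻¹ x - x), hda, v.map_sub_swap]
    rw [this]
    exact ha x hx

/-- The Herbrand function `φ_{F/K}` evaluated at integers. -/
def herbrandPhi (v : AddValuation F (WithTop ℤ)) (hv : GalInvariant K v) (n : ℤ) : ℚ :=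
  if n ≤ 0 then (n : ℚ)
  else (∑ i ∈ Finset.Icc (1 : ℤ) n, (Nat.card (lowerRG v hv i) : ℚ)) /
    (Nat.card (lowerRG v hv 0) : ℚ)

/-- The upper-numbering ramification subgroup `G^u = G_{ψ(u)}` of `Gal(F/K)`. -/
def upperRG (v : AddValuation F (WithTop ℤ)) (hv : GalInvariant K v) (u : ℤ) :
    Subgroup (F ≃ₐ[K] F) :=
  lowerRG v hv (sInf {n : ℤ | (u : ℚ) ≤ herbrandPhi v hv n})

/-- `t` is an upper ramification jump of `F/K`: `G^u ≠ G^t` for every `u > t`. -/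
def IsUpperJump (v : AddValuation F (WithTop ℤ)) (hv : GalInvariant K v) (t : ℤ) : Prop :=
  ∀ u : ℤ, t < u → upperRG v hv u ≠ upperRG v hv t

/-- A group is elementary abelian of exponent `p` if it is isomorphic to `(ℤ/pℤ)^k`
for some `k`. -/
def IsElemAbelian (p : ℕ) (G : Type*) [Group G] : Prop :=
  ∃ k : ℕ, Nonempty (G ≃* (Fin k → Multiplicative (ZMod p)))

/-- The norm group `N_{L/K}(L^×)`, as a subgroup of `K^×`. -/
def normGroup (K L : Type*) [Field K] [Field L] [Algebra K L] : Subgroup Kˣ :=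
  (Units.map (Algebra.norm K : L →* K)).range

/-- The residues of `c 0, …, c (f-1)` lie in the valuation ring and form a basis of
the residue field of `v` over `𝔽_p`. -/
def IsResidueBasis (p : ℕ) {K : Type*} [Field K] (v : AddValuation K (WithTop ℤ))
    {f : ℕ} (c : Fin f → K) : Prop :=
  (∀ y, 0 ≤ v (c y)) ∧
  (∀ a : Fin f → ℤ, (1 : WithTop ℤ) ≤ v (∑ y, (a y : K) * c y) → ∀ y, (p : ℤ) ∣ a y) ∧
  (∀ x : K, 0 ≤ v x → ∃ a : Fin f → ℤ, (1 : WithTop ℤ) ≤ v (x - ∑ y, (a y : K) * c y))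

/-- `v_L(𝒟_{L/K})`: the valuation of the different of `L/K`, defined through the
inverse different `{x ∈ L ∣ Tr_{L/K}(x·𝒪_L) ⊆ 𝒪_K} = 𝔪_L^{-d}`. -/
def differentVal (K : Type*) {L : Type*} [Field K] [Field L] [Algebra K L]
    (vK : AddValuation K (WithTop ℤ)) (vL : AddValuation L (WithTop ℤ)) : ℤ :=
  sSup {m : ℤ | ∃ x : L, vL x = ((-m : ℤ) : WithTop ℤ) ∧
    ∀ y : L, 0 ≤ vL y → 0 ≤ vK (Algebra.trace K L (x * y))}

/-- The maximal elementary abelian `p`-extension `𝒞_K(p)` of `K` inside `Ω`: the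
compositum of all cyclic (equivalently, normal) extensions of `K` of degree `p`. -/
def maxElemAbelian (p : ℕ) (K Ω : Type*) [Field K] [Field Ω] [Algebra K Ω] :
    IntermediateField K Ω :=
  ⨆ L ∈ {L : IntermediateField K Ω | Module.finrank K L = p ∧ Normal K L}, L

/-- The subgroup `U_K^{i+1} = 1 + 𝔪_K^{i+1}` of principal units of `K^×`
(the index is shifted by one so that `principalUnits v 0 = U_K^1`). -/
def principalUnits {K : Type*} [Field K] (v : AddValuation K (WithTop ℤ)) (i : ℕ) :
    Subgroup Kˣ where
  carrier := {x : Kˣ | (((i : ℤ) + 1 : ℤ) : WithTop ℤ) ≤ v ((x : K) - 1)}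
  one_mem' := by simp
  mul_mem' := by
    intro a b ha hb
    have hpos : (0 : WithTop ℤ) < (((i : ℤ) + 1 : ℤ) : WithTop ℤ) := by
      rw [show (0 : WithTop ℤ) = ((0 : ℤ) : WithTop ℤ) from rfl]
      exact WithTop.coe_lt_coe.mpr (by omega)
    have hva : v (a : K) = 0 := by
      have h1 : v ((1 : K)) < v ((a : K) - 1) := by
        rw [v.map_one]; exact lt_of_lt_of_le hpos ha
      have h2 := v.map_add_eq_of_lt_right h1
      rw [sub_add_cancel] at h2
      rw [h2, v.map_one]
    have key : ((a * b : Kˣ) : K) - 1 = (a : K) * ((b : K) - 1) + ((a : K) - 1) := by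
      push_cast; ring
    show (((i : ℤ) + 1 : ℤ) : WithTop ℤ) ≤ v (((a * b : Kˣ) : K) - 1)
    rw [key]
    refine v.map_le_add ?_ ha
    rw [v.map_mul, hva, zero_add]
    exact hb
  inv_mem' := by
    intro a ha
    have hpos : (0 : WithTop ℤ) < (((i : ℤ) + 1 : ℤ) : WithTop ℤ) := by
      rw [show (0 : WithTop ℤ) = ((0 : ℤ) : WithTop ℤ) from rfl]
      exact WithTop.coe_lt_coe.mpr (by omega)
    have hva : v (a : K) = 0 := by
      have h1 : v ((1 : K)) < v ((a : K) - 1) := by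
        rw [v.map_one]; exact lt_of_lt_of_le hpos ha
      have h2 := v.map_add_eq_of_lt_right h1
      rw [sub_add_cancel] at h2
      rw [h2, v.map_one]
    have key : ((a⁻¹ : Kˣ) : K) - 1 = ((a : K))⁻¹ * (1 - (a : K)) := by
      rw [mul_sub, mul_one, inv_mul_cancel₀ (Units.ne_zero a)]
      push_cast
      ring
    show (((i : ℤ) + 1 : ℤ) : WithTop ℤ) ≤ v (((a⁻¹ : Kˣ) : K) - 1)
    rw [key, v.map_mul, v.map_inv, hva, v.map_sub_swap]
    simpa using ha

/-- The valuation ring of an additive valuation. -/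
abbrev intRing {F : Type*} [Field F] (v : AddValuation F (WithTop ℤ)) : ValuationSubring F :=
  (AddValuation.toValuation v).valuationSubring

lemma mem_intRing {F : Type*} [Field F] {v : AddValuation F (WithTop ℤ)} {x : F} :
    x ∈ intRing v ↔ 0 ≤ v x := Iff.rfl

lemma residue_eq_zero {F : Type*} [Field F] {v : AddValuation F (WithTop ℤ)} (x : intRing v) :
    IsLocalRing.residue (intRing v) x = 0 ↔ 0 < v (x : F) := by
  rw [IsLocalRing.residue_eq_zero_iff]
  exact Valuation.mem_maximalIdeal_iff F (AddValuation.toValuation v)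

lemma one_le_iff_pos {a : WithTop ℤ} : 1 ≤ a ↔ 0 < a := by
  induction a using WithTop.recTopCoe with
  | top => simp
  | coe a => norm_cast

/-- A finite extension of `ℚ_p` has finite residue field. -/
theorem finite_residueField (p : ℕ) [Fact p.Prime] {F : Type*} [Field F] [Algebra ℚ_[p] F]
    [FiniteDimensional ℚ_[p] F] (v : AddValuation F (WithTop ℤ)) (e : ℕ) (he : 0 < e)
    (hv : ∀ x : ℚ_[p], x ≠ 0 → v (algebraMap ℚ_[p] F x) = ((e * x.valuation : ℤ) : WithTop ℤ)) :
    Finite (IsLocalRing.ResidueField (intRing v)) := by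
  have hint : ∀ z : ℤ_[p], 0 ≤ v (algebraMap ℚ_[p] F z) := by
    intro z
    by_cases hz : (z : ℚ_[p]) = 0
    · simp [hz]
    · rw [hv _ hz]
      have : 0 ≤ (z : ℚ_[p]).valuation := (Padic.norm_le_one_iff_val_nonneg _).1 z.2
      exact WithTop.coe_le_coe.2 (mul_nonneg (by positivity) this)
  have hmax : ∀ z : ℤ_[p], z ∈ IsLocalRing.maximalIdeal ℤ_[p] →
      0 < v (algebraMap ℚ_[p] F z) := by
    intro z hz
    by_cases hz0 : (z : ℚ_[p]) = 0
    · simp [hz0]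
    · rw [hv _ hz0]
      have : 0 < (z : ℚ_[p]).valuation := by
        rw [IsLocalRing.mem_maximalIdeal, PadicInt.mem_nonunits] at hz
        by_contra hc
        have h1 : (z : ℚ_[p])⁻¹.valuation ≥ 0 := by rw [Padic.valuation_inv]; omega
        have h2 := (Padic.norm_le_one_iff_val_nonneg _).2 h1
        rw [norm_inv] at h2
        have h3 : 0 < ‖(z : ℚ_[p])‖ := norm_pos_iff.2 hz0
        have := (inv_le_one₀ h3).1 h2
        rw [PadicInt.norm_def] at hz
        linarith
      exact WithTop.coe_lt_coe.2 (mul_pos (by positivity) this)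
  let ι : ℤ_[p] →+* intRing v :=
    ((algebraMap ℚ_[p] F).comp (PadicInt.Coe.ringHom)).codRestrict (intRing v).toSubring hint
  have hι : ∀ z, ((ι z : intRing v) : F) = algebraMap ℚ_[p] F z := fun z => rfl
  let ρ : ℤ_[p] →+* IsLocalRing.ResidueField (intRing v) :=
    (IsLocalRing.residue (intRing v)).comp ι
  have hρ : ∀ z ∈ IsLocalRing.maximalIdeal ℤ_[p], ρ z = 0 := fun z hz =>
    (residue_eq_zero _).2 (hmax z hz)
  have hp0 : ((p : ℕ) : IsLocalRing.ResidueField (intRing v)) = 0 := by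
    have := hρ (p : ℤ_[p]) (by
      rw [IsLocalRing.mem_maximalIdeal]; exact PadicInt.p_nonunit)
    simpa using this
  have : CharP (IsLocalRing.ResidueField (intRing v)) p :=
    (CharP.charP_iff_prime_eq_zero Fact.out).2 hp0
  let _ : Algebra (ZMod p) (IsLocalRing.ResidueField (intRing v)) := ZMod.algebra _ p
  have hρ' : ∀ z : ℤ_[p], ρ z = algebraMap (ZMod p) _ (PadicInt.toZMod z) := by
    intro z
    have h1 := hρ _ (PadicInt.sub_zmodRepr_mem z)
    have h2 : PadicInt.toZMod z = (z.zmodRepr : ZMod p) := by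
      have : z - z.zmodRepr ∈ RingHom.ker (PadicInt.toZMod (p := p)) := by
        rw [PadicInt.ker_toZMod]; exact PadicInt.sub_zmodRepr_mem z
      rw [RingHom.mem_ker, map_sub, sub_eq_zero, map_natCast] at this
      exact this
    rw [map_sub, sub_eq_zero, map_natCast] at h1
    rw [h1, h2, map_natCast]
  have hrank : Module.rank (ZMod p) (IsLocalRing.ResidueField (intRing v)) ≤
      (Module.finrank ℚ_[p] F : ℕ) := by
    refine rank_le fun s hs => ?_
    choose lift hlift using IsLocalRing.residue_surjective (R := intRing v)
    have hli : LinearIndependent ℚ_[p] (fun i : s => ((lift i.1 : intRing v) : F)) := by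
      rw [Fintype.linearIndependent_iff]
      intro c hc
      by_contra! hne
      obtain ⟨i₁, hi₁⟩ := hne
      obtain ⟨i₀, -, hi₀⟩ := Finset.exists_max_image Finset.univ (fun i => ‖c i‖)
        ⟨i₁, Finset.mem_univ _⟩
      have hc0 : c i₀ ≠ 0 := by
        intro h0
        have := hi₀ i₁ (Finset.mem_univ _)
        simp only [h0, norm_zero, norm_le_zero_iff] at this
        exact hi₁ this
      let d : s → ℤ_[p] := fun i => ⟨c i / c i₀, by
        rw [norm_div]
        exact div_le_one_of_le₀ (hi₀ i (Finset.mem_univ _)) (norm_nonneg _)⟩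
      have hd : ∑ i, ι (d i) * lift i.1 = 0 := by
        apply Subtype.ext
        have : ((∑ i, ι (d i) * lift i.1 : intRing v) : F) =
            (algebraMap ℚ_[p] F (c i₀))⁻¹ * ∑ i, c i • ((lift i.1 : intRing v) : F) := by
          rw [Finset.mul_sum]
          push_cast
          refine Finset.sum_congr rfl fun i _ => ?_
          rw [hι, Algebra.smul_def, ← mul_assoc, ← map_inv₀, ← map_mul]
          congr 2
          simp only [d]
          rw [div_eq_inv_mul]
        rw [this, hc, mul_zero]; rfl
      have hd' := congrArg (IsLocalRing.residue (intRing v)) hd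
      rw [map_sum, map_zero] at hd'
      have h3 : ∑ i : s, PadicInt.toZMod (d i) • (i : IsLocalRing.ResidueField (intRing v)) = 0 := by
        rw [← hd']
        refine Finset.sum_congr rfl fun i _ => ?_
        rw [map_mul, hlift, Algebra.smul_def, ← hρ']; rfl
      have h4 := Fintype.linearIndependent_iff.1 hs _ h3 i₀
      have h5 : d i₀ = 1 := Subtype.ext (div_self hc0)
      rw [h5, map_one] at h4
      exact one_ne_zero h4
    simpa using hli.fintype_card_le_finrank
  have : Module.Finite (ZMod p) (IsLocalRing.ResidueField (intRing v)) :=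
    Module.rank_lt_aleph0_iff.1 (hrank.trans_lt (Cardinal.natCast_lt_aleph0))
  exact Module.finite_of_finite (ZMod p)

section polynomial

open Polynomial

/-- The element `x` is integral and `ℤ[x]` is dense in the valuation ring of `v`. -/
def IsDenseGenerator {F : Type*} [Field F] (v : AddValuation F (WithTop ℤ)) (x : F) : Prop :=
  0 ≤ v x ∧ ∀ y : F, 0 ≤ v y → ∀ N : ℕ, ∃ g : ℤ[X], (N : WithTop ℤ) ≤ v (y - aeval x g)

lemma exists_isDenseGenerator {F : Type*} [Field F] (v : AddValuation F (WithTop ℤ))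
    (hv : IsNormalized v) [Finite (IsLocalRing.ResidueField (intRing v))] :
    ∃ x, IsDenseGenerator v x := by
  have := Fintype.ofFinite (IsLocalRing.ResidueField (intRing v))
  set q := Fintype.card (IsLocalRing.ResidueField (intRing v)) with hq
  set res := IsLocalRing.residue (intRing v) with hres
  obtain ⟨ϖ, hϖ⟩ := hv 1
  have hϖ1 : v ϖ = 1 := hϖ
  obtain ⟨u, hu⟩ := IsCyclic.exists_generator (α := (IsLocalRing.ResidueField (intRing v))ˣ)
  obtain ⟨a, ha⟩ := IsLocalRing.residue_surjective (R := intRing v) (u : IsLocalRing.ResidueField _)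
  let ϖ' : intRing v := ⟨ϖ, by rw [mem_intRing, hϖ1]; exact zero_le_one⟩
  have hresϖ : res ϖ' = 0 := (residue_eq_zero _).2 (by
    show 0 < v ϖ
    rw [hϖ1]; exact zero_lt_one)
  have hpos : ∀ b : intRing v, res b = u → 1 ≤ v ((b : F) ^ q - b) := by
    intro b hb
    rw [one_le_iff_pos]
    refine (residue_eq_zero (b ^ q - b)).1 ?_
    rw [map_sub, map_pow, hb, FiniteField.pow_card, sub_self]
  have key : ∃ b : intRing v, res b = u ∧ v ((b : F) ^ q - b) = 1 := by
    rcases (hpos a ha).eq_or_lt with h | h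
    · exact ⟨a, ha, h.symm⟩
    refine ⟨a + ϖ', by rw [map_add, hresϖ, add_zero]; exact ha, ?_⟩
    obtain ⟨k, hk⟩ := powAddExpansion a ϖ' q
    have hq0 : 1 ≤ v ((q : intRing v) : F) := by
      rw [one_le_iff_pos]
      refine (residue_eq_zero _).1 ?_
      rw [map_natCast]; exact FiniteField.cast_card_eq_zero _
    have h1 : 1 < v ((a : F) ^ q - a + (q : intRing v) * ((a ^ (q - 1) : intRing v) : F) * ϖ
        + k * ϖ ^ 2) := by
      have h2 : (1 : WithTop ℤ) < 1 + 1 := by decide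
      refine v.map_lt_add (v.map_lt_add h ?_) ?_
      · rw [v.map_mul, v.map_mul, hϖ1]
        refine h2.trans_le (add_le_add_left ?_ 1)
        exact hq0.trans (le_add_of_nonneg_right (a ^ (q - 1)).2)
      · rw [v.map_mul, v.map_pow, hϖ1, two_nsmul]
        exact h2.trans_le (le_add_of_nonneg_left k.2)
    have h3 : (((a + ϖ' : intRing v) : F)) ^ q - ((a + ϖ' : intRing v) : F) =
        ((a : F) ^ q - a + (q : intRing v) * ((a ^ (q - 1) : intRing v) : F) * ϖ
        + k * ϖ ^ 2) - ϖ := by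
      have := congrArg (Subtype.val : intRing v → F) hk
      push_cast at this ⊢
      rw [this]
      simp only [ϖ']
      ring
    rw [h3, v.map_sub_eq_of_lt_right (by rw [hϖ1]; exact h1), hϖ1]
  obtain ⟨b, hb, hb1⟩ := key
  set π : F := (b : F) ^ q - b with hπ
  have hπ0 : π ≠ 0 := by
    intro h0; rw [h0, v.map_zero] at hb1; exact absurd hb1 (by decide)
  have step : ∀ y : F, 0 ≤ v y → ∃ g : ℤ[X], 1 ≤ v (y - aeval (b : F) g) := by
    intro y hy
    by_cases h0 : res ⟨y, hy⟩ = 0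
    · refine ⟨0, ?_⟩
      rw [map_zero, sub_zero, one_le_iff_pos]
      exact (residue_eq_zero _).1 h0
    · obtain ⟨n, hn⟩ := (Submonoid.mem_powers_iff _ _).1
        ((mem_powers_iff_mem_zpowers).2 (hu (Units.mk0 _ h0)))
      refine ⟨X ^ n, ?_⟩
      rw [one_le_iff_pos]
      have : res (⟨y, hy⟩ - b ^ n) = 0 := by
        rw [map_sub, map_pow, hb, ← Units.val_pow_eq_pow_val, hn, Units.val_mk0, sub_self]
      simpa using (residue_eq_zero _).1 this
  refine ⟨b, b.2, fun y hy N => ?_⟩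
  induction N with
  | zero => exact ⟨0, by simpa using hy⟩
  | succ N ih =>
    obtain ⟨g, hg⟩ := ih
    have hvN : v (π ^ N) = (N : WithTop ℤ) := by rw [v.map_pow, hb1, nsmul_one]
    obtain ⟨h, hh⟩ := step ((y - aeval (b : F) g) / π ^ N) (by
      have h1 : v ((y - aeval (b : F) g) / π ^ N * π ^ N) = v (y - aeval (b : F) g) := by
        rw [div_mul_cancel₀ _ (pow_ne_zero _ hπ0)]
      rw [v.map_mul, hvN] at h1
      rw [← h1] at hg
      generalize v ((y - aeval (b : F) g) / π ^ N) = c at hg ⊢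
      induction c using WithTop.recTopCoe with
      | top => exact le_top
      | coe c =>
        have : ((N : ℤ) : WithTop ℤ) ≤ ((c + N : ℤ) : WithTop ℤ) := hg
        rw [WithTop.coe_le_coe] at this
        exact WithTop.coe_le_coe.2 (by omega))
    refine ⟨g + (X ^ q - X) ^ N * h, ?_⟩
    have h2 : y - aeval (b : F) (g + (X ^ q - X) ^ N * h) =
        π ^ N * ((y - aeval (b : F) g) / π ^ N - aeval (b : F) h) := by
      rw [mul_sub, mul_div_cancel₀ _ (pow_ne_zero _ hπ0)]
      simp only [map_add, map_mul, map_pow, map_sub, aeval_X, hπ]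
      ring
    rw [h2, v.map_mul, hvN, Nat.cast_succ]
    exact add_le_add_right hh _

/-- A polynomial with integral coefficients which is small at all points of a finite set `s`
takes at `x` a value at least as divisible as `∏ z ∈ s, (x - z)`. -/
lemma val_eval_ge_of_small_on {F : Type*} [Field F] (v : AddValuation F (WithTop ℤ))
    (x : intRing v) (s : Finset (intRing v)) :
    ∃ B : ℕ, ∀ (N : ℤ) (G : (intRing v)[X]), (∀ z ∈ s, (N : WithTop ℤ) ≤ v (G.eval z : intRing v)) →
      min ((N - B : ℤ) : WithTop ℤ) (∑ z ∈ s, v ((x : F) - z)) ≤ v (G.eval x : intRing v) := by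
  induction s using Finset.induction_on with
  | empty => exact ⟨0, fun N G _ => by
      rw [Finset.sum_empty]; exact (min_le_right _ _).trans (G.eval x).2⟩
  | insert z₀ s hz₀ ih =>
    obtain ⟨B, hB⟩ := ih
    have hD : ∃ D : ℕ, ∀ z ∈ s, v ((z : F) - z₀) ≤ ((D : ℤ) : WithTop ℤ) := by
      have : ∀ z : intRing v, ∃ D : ℕ, z ≠ z₀ → v ((z : F) - z₀) ≤ ((D : ℤ) : WithTop ℤ) := by
        intro z
        by_cases h : z = z₀
        · exact ⟨0, fun h' => absurd h h'⟩
        · have h1 : (z : F) - z₀ ≠ 0 := sub_ne_zero.2 (fun h' => h (Subtype.ext h'))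
          obtain ⟨d, hd⟩ := WithTop.ne_top_iff_exists.1 (v.ne_top_iff.2 h1)
          exact ⟨d.toNat, fun _ => by rw [← hd]; exact WithTop.coe_le_coe.2 (Int.self_le_toNat d)⟩
      choose D hD using this
      refine ⟨s.sup D, fun z hz => (hD z (fun h => hz₀ (h ▸ hz))).trans ?_⟩
      exact WithTop.coe_le_coe.2 (by exact_mod_cast Finset.le_sup (f := D) hz)
    obtain ⟨D, hD⟩ := hD
    refine ⟨B + D, fun N G hG => ?_⟩
    obtain ⟨G₁, hG₁⟩ : X - C z₀ ∣ G - C (G.eval z₀) := X_sub_C_dvd_sub_C_eval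
    have hev : ∀ z : intRing v, G.eval z = G.eval z₀ + (z - z₀) * G₁.eval z := by
      intro z
      have := congrArg (eval z) hG₁
      simp only [eval_sub, eval_C, eval_mul, eval_X] at this
      rw [← this]; ring
    have h0 : (N : WithTop ℤ) ≤ v (G.eval z₀ : intRing v) := hG _ (Finset.mem_insert_self _ _)
    have h1 := hB (N - D) G₁ (fun z hz => by
      have h2 : (N : WithTop ℤ) ≤ v ((G.eval z - G.eval z₀ : intRing v) : F) := by
        push_cast
        exact v.map_le_sub (hG _ (Finset.mem_insert_of_mem hz)) h0
      rw [hev z, add_sub_cancel_left] at h2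
      push_cast at h2
      rw [v.map_mul] at h2
      have h3 := h2.trans (add_le_add_left (hD z hz) _)
      generalize v (G₁.eval z : intRing v) = c at h3 ⊢
      induction c using WithTop.recTopCoe with
      | top => exact le_top
      | coe c =>
        rw [← WithTop.coe_add, WithTop.coe_le_coe] at h3
        exact WithTop.coe_le_coe.2 (by omega))
    rw [hev x, Finset.sum_insert hz₀, Nat.cast_add]
    show _ ≤ v ((G.eval z₀ : intRing v) + ((x : F) - z₀) * (G₁.eval x : intRing v))
    refine v.map_le_add (((min_le_left _ _).trans (WithTop.coe_le_coe.2 (by omega))).trans h0) ?_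
    rw [v.map_mul]
    have hxz : 0 ≤ v ((x : F) - z₀) := (x - z₀).2
    refine le_trans ?_ (add_le_add_right h1 _)
    rcases min_choice ((N - D - B : ℤ) : WithTop ℤ) (∑ z ∈ s, v ((x : F) - z)) with h | h <;> rw [h]
    · refine (min_le_left _ _).trans (le_trans (WithTop.coe_le_coe.2 ?_) (le_add_of_nonneg_left hxz))
      omega
    · exact min_le_right _ _

lemma val_prod {F ι : Type*} [Field F] (v : AddValuation F (WithTop ℤ)) (s : Finset ι)
    (f : ι → F) : v (∏ i ∈ s, f i) = ∑ i ∈ s, v (f i) := by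
  induction s using Finset.induction_on with
  | empty => simp
  | insert a s ha ih => rw [Finset.prod_insert ha, Finset.sum_insert ha, v.map_mul, ih]

lemma le_of_forall_min_le {S w : WithTop ℤ} (B : ℕ)
    (h : ∀ N : ℕ, min (((N : ℤ) - B : ℤ) : WithTop ℤ) S ≤ w) : S ≤ w := by
  induction w using WithTop.recTopCoe with
  | top => exact le_top
  | coe w =>
    refine (min_le_iff.1 (h ((w + 1).toNat + B))).resolve_left fun h' => ?_
    have := WithTop.coe_le_coe.1 h'
    push_cast at this
    omega

/-- Polynomials with integral coefficients are closed under products of linear factors. -/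
lemma val_coeff_prod_X_sub_C_nonneg {F ι : Type*} [Field F] (v : AddValuation F (WithTop ℤ))
    (s : Finset ι) (f : ι → F) (hf : ∀ i ∈ s, 0 ≤ v (f i)) (n : ℕ) :
    0 ≤ v ((∏ i ∈ s, (X - C (f i))).coeff n) := by
  have : ∏ i ∈ s, (X - C (f i)) ∈ lifts (intRing v).subtype := by
    refine Subsemiring.prod_mem _ fun i hi => ?_
    exact (lifts_iff_coeff_lifts _).2 fun m => by
      rw [coeff_sub]
      rcases m with _ | _ | m <;> simp [coeff_X, coeff_C]
      exact hf i hi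
  obtain ⟨a, ha⟩ := (lifts_iff_coeff_lifts _).1 this n
  rw [← ha]
  exact a.2

/-- For `y` generating the invariants of `H` and `x` generating everything, the ramification
number of `g` on `y` is the sum of the ramification numbers on `x` over the coset `g H`. -/
theorem val_smul_sub_eq_sum {F G : Type*} [Field F] [Group G] [MulSemiringAction G F]
    (v : AddValuation F (WithTop ℤ)) (hinv : ∀ (g : G) (x : F), v (g • x) = v x)
    (H : Subgroup G) [Fintype H] {x y : F} (hx : IsDenseGenerator v x)
    (hxH : ∀ h h' : H, h • x = h' • x → h = h')
    (hy0 : 0 ≤ v y) (hyH : ∀ h : H, h • y = y) (g : G)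
    (hy : ∀ c, 0 ≤ v c → (∀ h : H, h • c = c) → v (g • y - y) ≤ v (g • c - c)) :
    v (g • y - y) = ∑ h : H, v (g • h • x - x) := by
  apply le_antisymm
  · set f := MulSemiringAction.charpoly H x with hf
    have hf0 : f.eval x = 0 := MulSemiringAction.eval_charpoly H x
    have hprod : (f.map (MulSemiringAction.toRingHom G F g)).eval x =
        ∏ h : H, (x - g • h • x) := by
      rw [hf, MulSemiringAction.charpoly_eq, Polynomial.map_prod, eval_prod]
      refine Finset.prod_congr rfl fun h _ => ?_
      simp
    have hsum : v (∏ h : H, (x - g • h • x)) = ∑ h : H, v (g • h • x - x) := by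
      rw [val_prod]
      exact Finset.sum_congr rfl fun h _ => v.map_sub_swap _ _
    rw [← hsum, ← hprod, ← sub_zero (eval x (f.map _)), ← hf0,
      eval_eq_sum_range' (n := f.natDegree + 1) (Nat.lt_succ_of_le natDegree_map_le),
      eval_eq_sum_range, ← Finset.sum_sub_distrib]
    refine v.map_le_sum fun j _ => ?_
    rw [coeff_map, ← sub_mul, v.map_mul, v.map_pow]
    refine le_trans ?_ (le_add_of_nonneg_right (nsmul_nonneg hx.1 j))
    refine hy _ ?_ fun h => MulSemiringAction.smul_coeff_charpoly x j h
    rw [hf, MulSemiringAction.charpoly_eq]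
    refine val_coeff_prod_X_sub_C_nonneg v _ _ (fun h _ => ?_) j
    exact (hinv h x).symm ▸ hx.1
  · let z : H → intRing v := fun h => ⟨g • h • x, by
      rw [mem_intRing, hinv]; exact (hinv h x).symm ▸ hx.1⟩
    have hz : Function.Injective z := fun h h' hh => by
      have : g • h • x = g • h' • x := congrArg Subtype.val hh
      exact hxH _ _ (smul_left_cancel g this)
    obtain ⟨B, hB⟩ := val_eval_ge_of_small_on v ⟨x, hx.1⟩ (Finset.univ.image z)
    refine le_of_forall_min_le B fun N => ?_
    obtain ⟨P, hP⟩ := hx.2 y hy0 N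
    let Q : (intRing v)[X] := P.map (Int.castRingHom _) - C ⟨g • y, mem_intRing.2 ((hinv g y).symm ▸ hy0)⟩
    have hQ : ∀ w : intRing v, ((Q.eval w : intRing v) : F) = aeval (w : F) P - g • y := by
      intro w
      have h1 : ((eval w (P.map (Int.castRingHom (intRing v))) : intRing v) : F) =
          aeval (w : F) P := by
        rw [eval_map, show ((eval₂ (Int.castRingHom _) w P : intRing v) : F) =
          (intRing v).subtype (eval₂ (Int.castRingHom _) w P) from rfl, hom_eval₂, aeval_def]
        congr 1
      simp only [Q, eval_sub, eval_C]
      push_cast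
      rw [h1]
    have hsm : ∀ (a : G) (w : F), aeval (a • w) P = a • aeval w P := by
      intro a w
      have := Polynomial.hom_eval₂ P (algebraMap ℤ F) (MulSemiringAction.toRingHom G F a) w
      rw [aeval_def, aeval_def]
      simp only [MulSemiringAction.toRingHom_apply] at this
      rw [this]
      congr 1
      exact RingHom.ext_int _ _
    have h2 := hB N Q (fun w hw => by
      obtain ⟨h, -, rfl⟩ := Finset.mem_image.1 hw
      rw [hQ]
      have : aeval ((z h : intRing v) : F) P - g • y = g • h • (aeval x P - y) := by
        show aeval (g • h • x) P - g • y = _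
        rw [smul_sub, smul_sub, hyH, hsm]
        congr 2
        exact hsm h x
      rw [this, hinv, show v (h • (aeval x P - y)) = v (aeval x P - y) from hinv h _,
        v.map_sub_swap]
      exact hP)
    rw [hQ, Finset.sum_image (fun _ _ _ _ h => hz h)] at h2
    have h3 : g • y - y = -((y - aeval x P) + (aeval x P - g • y)) := by ring
    rw [h3, v.map_neg]
    refine v.map_le_add (((min_le_left _ _).trans (WithTop.coe_le_coe.2 (by omega))).trans hP)
      (le_trans (le_of_eq ?_) h2)
    congr 1
    exact Finset.sum_congr rfl fun h _ => v.map_sub_swap _ _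

end polynomial

lemma eq_mul_of_val_le {F : Type*} [Field F] (v : AddValuation F (WithTop ℤ)) {x y : intRing v}
    (hy : (y : F) ≠ 0) (h : v (y : F) ≤ v (x : F)) : y ∣ x := by
  refine ⟨⟨x / y, ?_⟩, Subtype.ext (by simp [mul_div_cancel₀ _ hy])⟩
  rw [mem_intRing]
  have h1 : v ((x : F) / y * y) = v (x : F) := by rw [div_mul_cancel₀ _ hy]
  rw [v.map_mul] at h1
  rw [← h1] at h
  obtain ⟨c, hc⟩ := WithTop.ne_top_iff_exists.1 (v.ne_top_iff.2 hy)
  rw [← hc] at h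
  generalize v ((x : F) / y) = d at h ⊢
  induction d using WithTop.recTopCoe with
  | top => exact le_top
  | coe d =>
    rw [← WithTop.coe_add, WithTop.coe_le_coe] at h
    exact WithTop.coe_le_coe.2 (by omega)

lemma dvd_iff_val_le {F : Type*} [Field F] (v : AddValuation F (WithTop ℤ)) {x y : intRing v}
    (hy : (y : F) ≠ 0) : y ∣ x ↔ v (y : F) ≤ v (x : F) := by
  refine ⟨?_, eq_mul_of_val_le v hy⟩
  rintro ⟨c, rfl⟩
  push_cast
  rw [v.map_mul]
  exact le_add_of_nonneg_right c.2

lemma ne_zero_of_val_eq_coe {F : Type*} [Field F] (v : AddValuation F (WithTop ℤ)) {x : F} {n : ℤ}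
    (h : v x = n) : x ≠ 0 := by
  rintro rfl
  rw [v.map_zero] at h
  exact absurd h (by simp)

lemma exists_uniformizer {F : Type*} [Field F] (v : AddValuation F (WithTop ℤ))
    (hv : IsNormalized v) : ∃ ϖ : intRing v, v (ϖ : F) = ((1 : ℤ) : WithTop ℤ) := by
  obtain ⟨ϖ, hϖ⟩ := hv 1
  exact ⟨⟨ϖ, by rw [mem_intRing, hϖ]; exact WithTop.coe_le_coe.2 zero_le_one⟩, hϖ⟩

lemma maximalIdeal_pow_eq {F : Type*} [Field F] (v : AddValuation F (WithTop ℤ))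
    {ϖ : intRing v} (hϖ : v (ϖ : F) = ((1 : ℤ) : WithTop ℤ)) (n : ℕ) (x : intRing v) :
    x ∈ IsLocalRing.maximalIdeal (intRing v) ^ n ↔ (n : WithTop ℤ) ≤ v (x : F) := by
  have h0 : (ϖ : F) ≠ 0 := ne_zero_of_val_eq_coe v hϖ
  have h1 : IsLocalRing.maximalIdeal (intRing v) = Ideal.span {ϖ} := by
    ext y
    rw [Ideal.mem_span_singleton, dvd_iff_val_le v h0, hϖ, ← IsLocalRing.residue_eq_zero_iff,
      residue_eq_zero, ← one_le_iff_pos]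
    rfl
  rw [h1, Ideal.span_singleton_pow, Ideal.mem_span_singleton,
    dvd_iff_val_le v (by push_cast; exact pow_ne_zero _ h0)]
  push_cast
  rw [v.map_pow, hϖ, show (((1 : ℤ) : WithTop ℤ)) = 1 from rfl, nsmul_one]

lemma isDiscreteValuationRing_intRing {F : Type*} [Field F] (v : AddValuation F (WithTop ℤ))
    (hv : IsNormalized v) : IsDiscreteValuationRing (intRing v) := by
  obtain ⟨ϖ, hϖ⟩ := exists_uniformizer v hv
  have h0 : (ϖ : F) ≠ 0 := ne_zero_of_val_eq_coe v hϖ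
  have hunit : ∀ x : intRing v, IsUnit x ↔ v (x : F) = 0 := by
    intro x
    rw [isUnit_iff_dvd_one]
    constructor
    · rintro ⟨y, hy⟩
      have := congrArg (fun z : intRing v => v (z : F)) hy
      push_cast at this
      rw [v.map_one, v.map_mul] at this
      have hx := x.2
      have hy := y.2
      rw [mem_intRing] at hx hy
      exact le_antisymm ((le_add_of_nonneg_right hy).trans this.symm.le) hx
    · intro h
      have hx : (x : F) ≠ 0 := ne_zero_of_val_eq_coe v (n := 0) h
      rw [dvd_iff_val_le v hx, h]
      simp
  refine IsDiscreteValuationRing.ofHasUnitMulPowIrreducibleFactorization ⟨ϖ, ⟨?_, ?_⟩, ?_⟩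
  · rw [hunit, hϖ]
    decide
  · intro a b hab
    rw [hunit, hunit]
    have := congrArg (fun z : intRing v => v (z : F)) hab
    push_cast at this
    rw [v.map_mul, hϖ] at this
    have ha := a.2
    have hb := b.2
    rw [mem_intRing] at ha hb
    generalize v (a : F) = c at *
    generalize v (b : F) = d at *
    induction c using WithTop.recTopCoe with
    | top => simp at this
    | coe c =>
      induction d using WithTop.recTopCoe with
      | top => simp at this
      | coe d =>
        norm_cast at *
        omega
  · intro x hx
    have hx' : (x : F) ≠ 0 := fun h => hx (Subtype.ext h)
    obtain ⟨c, hc⟩ := WithTop.ne_top_iff_exists.1 (v.ne_top_iff.2 hx')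
    have hc0 : 0 ≤ c := by
      have := x.2
      rw [mem_intRing, ← hc] at this
      exact WithTop.coe_le_coe.1 this
    have hp : ((ϖ ^ c.toNat : intRing v) : F) ≠ 0 := by push_cast; exact pow_ne_zero _ h0
    have hpv : v ((ϖ ^ c.toNat : intRing v) : F) = v (x : F) := by
      push_cast
      rw [v.map_pow, hϖ, show (((1 : ℤ) : WithTop ℤ)) = 1 from rfl, nsmul_one, ← hc]
      exact congrArg WithTop.some (Int.toNat_of_nonneg hc0)
    exact ⟨c.toNat, associated_of_dvd_dvd ((dvd_iff_val_le v hp).2 hpv.le)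
      ((dvd_iff_val_le v hx').2 hpv.ge)⟩

lemma nonneg_of_nsmul_nonneg {e : ℕ} (he : 0 < e) {a : WithTop ℤ} (h : 0 ≤ e • a) : 0 ≤ a := by
  induction a using WithTop.recTopCoe with
  | top => exact le_top
  | coe a =>
    have : (0 : WithTop ℤ) ≤ ((e • a : ℤ) : WithTop ℤ) := h
    have := WithTop.coe_le_coe.1 this
    refine WithTop.coe_le_coe.2 ?_
    rw [nsmul_eq_mul] at this
    exact nonneg_of_mul_nonneg_right this (by exact_mod_cast he)

lemma Extends.val_nonneg_iff {L M : Type*} [Field L] [Field M] [Algebra L M]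
    {vL : AddValuation L (WithTop ℤ)} {vM : AddValuation M (WithTop ℤ)} {e : ℕ}
    (h : Extends vL vM e) (x : L) : 0 ≤ vM (algebraMap L M x) ↔ 0 ≤ vL x := by
  rw [h.2]
  exact ⟨nonneg_of_nsmul_nonneg h.1, fun h' => nsmul_nonneg h' e⟩

/-- The order of the inertia group is the ramification index. -/
theorem card_lowerRG_zero {L M : Type*} [Field L] [Field M] [Algebra L M] [FiniteDimensional L M]
    [IsGalois L M] (vL : AddValuation L (WithTop ℤ)) (vM : AddValuation M (WithTop ℤ))
    (hL : IsNormalized vL) (hM : IsNormalized vM) (e : ℕ) (hext : Extends vL vM e)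
    (hG : GalInvariant L vM) [Finite (IsLocalRing.ResidueField (intRing vL))] :
    Nat.card (lowerRG vM hG 0) = e := by
  obtain ⟨ϖ, hϖ⟩ := exists_uniformizer vM hM
  obtain ⟨π, hπ⟩ := exists_uniformizer vL hL
  have hextV : (AddValuation.toValuation vL).HasExtension (AddValuation.toValuation vM) := by
    refine ⟨Valuation.isEquiv_iff_val_le_one.2 fun {x} => ?_⟩
    exact (hext.val_nonneg_iff x).symm
  have := isDiscreteValuationRing_intRing vL hL
  have := isDiscreteValuationRing_intRing vM hM
  let _ : MulSemiringAction (M ≃ₐ[L] M) (intRing vM) :=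
    { smul := fun σ x => ⟨σ x, by rw [mem_intRing, hG]; exact x.2⟩
      one_smul := fun x => rfl
      mul_smul := fun σ τ x => rfl
      smul_zero := fun σ => Subtype.ext (map_zero σ)
      smul_add := fun σ x y => Subtype.ext (map_add σ _ _)
      smul_one := fun σ => Subtype.ext (map_one σ)
      smul_mul := fun σ x y => Subtype.ext (map_mul σ _ _) }
  have hsmul : ∀ (σ : M ≃ₐ[L] M) (x : intRing vM), ((σ • x : intRing vM) : M) = σ x :=
    fun _ _ => rfl
  have : IsGaloisGroup (M ≃ₐ[L] M) (intRing vL) (intRing vM) := by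
    refine ⟨⟨fun {σ τ} h => ?_⟩, ⟨fun σ a b => ?_⟩, ⟨fun b hb => ?_⟩⟩
    · ext z
      obtain ⟨x, y, -, rfl⟩ := IsFractionRing.div_surjective (A := intRing vM) z
      have hx := congrArg Subtype.val (h x)
      have hy := congrArg Subtype.val (h y)
      rw [hsmul, hsmul] at hx hy
      rw [map_div₀, map_div₀]
      exact congrArg₂ _ hx hy
    · apply Subtype.ext
      rw [hsmul, Algebra.smul_def, Algebra.smul_def]
      push_cast
      rw [map_mul, hsmul]
      congr 1
      exact σ.commutes a
    · obtain ⟨a, ha⟩ := (IsGalois.mem_bot_iff_fixed (F := L) (E := M) (b : M)).2 fun σ =>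
        congrArg Subtype.val (hb σ)
      refine ⟨⟨a, (hext.val_nonneg_iff a).1 ?_⟩, Subtype.ext ha⟩
      have h1 : algebraMap L M a = b := ha
      rw [h1]
      exact b.2
  have hint : Algebra.IsIntegral (intRing vL) (intRing vM) :=
    Algebra.IsInvariant.isIntegral _ _ (M ≃ₐ[L] M)
  have : IsIntegralClosure (intRing vM) (intRing vL) M :=
    IsIntegralClosure.of_isIntegrallyClosed _ _ _
  have : Module.Finite (intRing vL) (intRing vM) := IsIntegralClosure.finite _ L M _
  have hinj : Function.Injective (algebraMap (intRing vL) (intRing vM)) := fun x y h =>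
    Subtype.ext ((algebraMap L M).injective (congrArg Subtype.val h))
  have : Module.IsTorsionFree (intRing vL) (intRing vM) :=
    Module.isTorsionFree_iff_algebraMap_injective.2 hinj
  have : Finite ((intRing vL) ⧸ IsLocalRing.maximalIdeal (intRing vL)) :=
    inferInstanceAs (Finite (IsLocalRing.ResidueField (intRing vL)))
  have hmem : ∀ σ : M ≃ₐ[L] M, σ ∈ lowerRG vM hG 0 ↔
      σ ∈ (IsLocalRing.maximalIdeal (intRing vM)).inertia (M ≃ₐ[L] M) := by
    intro σ
    have h1 : ∀ x : intRing vM, (σ • x - x ∈ IsLocalRing.maximalIdeal (intRing vM) ↔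
        (1 : WithTop ℤ) ≤ vM (σ x - x)) := fun x => by
      have := maximalIdeal_pow_eq vM hϖ 1 (σ • x - x)
      rwa [pow_one] at this
    exact ⟨fun h x => (h1 x).2 (h x x.2), fun h x hx => (h1 ⟨x, hx⟩).1 (h ⟨x, hx⟩)⟩
  rw [Nat.card_congr (Equiv.subtypeEquivRight hmem)]
  refine (Ideal.card_inertia_eq_ramificationIdxIn (G := M ≃ₐ[L] M)
    (IsLocalRing.maximalIdeal (intRing vL)) (IsLocalRing.maximalIdeal (intRing vM))).trans ?_
  rw [Ideal.ramificationIdxIn_eq_ramificationIdx _ (IsLocalRing.maximalIdeal (intRing vM))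
    (M ≃ₐ[L] M), ← Ideal.ramificationIdx'_eq_ramificationIdx
      (IsLocalRing.maximalIdeal (intRing vL)) _ (IsDiscreteValuationRing.not_a_field _)]
  have hval : ∀ x : intRing vL, vM (algebraMap (intRing vL) (intRing vM) x : intRing vM) =
    e • vL x := fun x => hext.2 x
  refine Ideal.ramificationIdx'_spec ?_ ?_
  · rw [Ideal.map_le_iff_le_comap]
    intro x hx
    rw [Ideal.mem_comap, maximalIdeal_pow_eq vM hϖ, hval]
    have := maximalIdeal_pow_eq vL hπ 1 x
    rw [pow_one] at this
    have := nsmul_le_nsmul_right (this.1 hx) e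
    simpa using this
  · intro hle
    have h1 := Ideal.map_le_iff_le_comap.1 hle (x := π) (by
      have := maximalIdeal_pow_eq vL hπ 1 π
      rw [pow_one] at this
      rw [this, hπ]; rfl)
    rw [Ideal.mem_comap, maximalIdeal_pow_eq vM hϖ, hval, hπ] at h1
    have h2 : (((e + 1 : ℕ) : ℤ) : WithTop ℤ) ≤ ((e • (1 : ℤ) : ℤ) : WithTop ℤ) := h1
    have h3 := WithTop.coe_le_coe.1 h2
    simp at h3

section herbrand
variable (v : AddValuation F (WithTop ℤ)) (hv : GalInvariant K v)

lemma lowerRG_antitone : Antitone (lowerRG v hv) := fun _ _ hij _ hσ x hx =>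
  le_trans (WithTop.coe_le_coe.2 (by omega)) (hσ x hx)

lemma lowerRG_neg_one : lowerRG v hv (-1) = ⊤ := by
  refine eq_top_iff.2 fun σ _ x hx => ?_
  exact v.map_le_sub ((hv σ x).symm ▸ hx) hx

lemma herbrandPhi_of_nonpos {n : ℤ} (hn : n ≤ 0) : herbrandPhi v hv n = n := if_pos hn

lemma herbrandPhi_of_nonneg {n : ℤ} (hn : 0 ≤ n) : herbrandPhi v hv n =
    (∑ i ∈ Finset.Icc (1 : ℤ) n, (Nat.card (lowerRG v hv i) : ℚ)) /
      (Nat.card (lowerRG v hv 0) : ℚ) := by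
  rcases hn.eq_or_lt with rfl | hn
  · simp [herbrandPhi]
  · exact if_neg (not_le.2 hn)

lemma herbrandPhi_monotone : Monotone (herbrandPhi v hv) := by
  refine monotone_int_of_le_succ fun n => ?_
  rcases lt_or_ge n 0 with hn | hn
  · rw [herbrandPhi_of_nonpos v hv hn.le, herbrandPhi_of_nonpos v hv (by omega)]
    push_cast
    linarith
  · rw [herbrandPhi_of_nonneg v hv hn, herbrandPhi_of_nonneg v hv (by omega)]
    gcongr
    omega

lemma bddBelow_le_herbrandPhi (u : ℤ) : BddBelow {n : ℤ | (u : ℚ) ≤ herbrandPhi v hv n} := by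
  refine ⟨min u 0, fun n hn => ?_⟩
  rcases le_or_gt n 0 with h | h
  · rw [Set.mem_ofPred_eq, herbrandPhi_of_nonpos v hv h] at hn
    exact (min_le_left _ _).trans (by exact_mod_cast hn)
  · exact (min_le_right _ _).trans h.le

variable [FiniteDimensional K F]

lemma card_lowerRG_pos (i : ℤ) : 0 < Nat.card (lowerRG v hv i) := Nat.card_pos

lemma nonempty_le_herbrandPhi (u : ℤ) : {n : ℤ | (u : ℚ) ≤ herbrandPhi v hv n}.Nonempty := by
  have h0 : (0 : ℚ) < Nat.card (lowerRG v hv 0) := by exact_mod_cast card_lowerRG_pos v hv 0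
  have hn : (0 : ℤ) ≤ max u 0 * Nat.card (lowerRG v hv 0) :=
    mul_nonneg (le_max_right _ _) (by positivity)
  refine ⟨max u 0 * Nat.card (lowerRG v hv 0), ?_⟩
  rw [Set.mem_ofPred_eq, herbrandPhi_of_nonneg v hv hn, le_div_iff₀ h0]
  have h1 : ∑ i ∈ Finset.Icc (1 : ℤ) (max u 0 * Nat.card (lowerRG v hv 0)), (1 : ℚ) ≤
      ∑ i ∈ Finset.Icc (1 : ℤ) (max u 0 * Nat.card (lowerRG v hv 0)),
        (Nat.card (lowerRG v hv i) : ℚ) :=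
    Finset.sum_le_sum fun i _ => by exact_mod_cast card_lowerRG_pos v hv i
  refine le_trans ?_ h1
  rw [Finset.sum_const, Int.card_Icc, nsmul_one, add_sub_cancel_right]
  have h2 : (((max u 0 * Nat.card (lowerRG v hv 0)).toNat : ℤ) : ℚ) =
      ((max u 0 * Nat.card (lowerRG v hv 0) : ℤ) : ℚ) := by rw [Int.toNat_of_nonneg hn]
  rw [Int.cast_natCast] at h2
  rw [h2]
  push_cast
  gcongr
  exact le_max_left _ _

lemma le_herbrandPhi_sInf (u : ℤ) :
    (u : ℚ) ≤ herbrandPhi v hv (sInf {n : ℤ | (u : ℚ) ≤ herbrandPhi v hv n}) :=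
  Int.csInf_mem (nonempty_le_herbrandPhi v hv u) (bddBelow_le_herbrandPhi v hv u)

lemma upperRG_antitone : Antitone (upperRG v hv) := fun a b hab =>
  lowerRG_antitone v hv (csInf_le_csInf (bddBelow_le_herbrandPhi v hv a)
    (nonempty_le_herbrandPhi v hv b) fun n (hn : (b : ℚ) ≤ _) =>
      show (a : ℚ) ≤ herbrandPhi v hv n from le_trans (by exact_mod_cast hab) hn)

/-- If the lower filtration drops from the whole group to the trivial group at `t`, then `t` is an
upper ramification jump. -/
lemma isUpperJump_of_lowerRG [Nontrivial (F ≃ₐ[K] F)] {t : ℤ}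
    (htop : ∀ i ≤ t, lowerRG v hv i = ⊤) (hbot : ∀ i, t < i → lowerRG v hv i = ⊥) :
    IsUpperJump v hv t := by
  have hphi : ∀ n ≤ t, herbrandPhi v hv n = n := by
    intro n hn
    rcases le_or_gt n 0 with h | h
    · exact herbrandPhi_of_nonpos v hv h
    · have h0 : (0 : ℚ) < Nat.card (lowerRG v hv 0) := by exact_mod_cast card_lowerRG_pos v hv 0
      rw [herbrandPhi_of_nonneg v hv h.le, div_eq_iff h0.ne',
        Finset.sum_congr rfl (g := fun _ => (Nat.card (lowerRG v hv 0) : ℚ)) (fun i hi => by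
          rw [htop i ((Finset.mem_Icc.1 hi).2.trans hn), htop 0 (by omega)]),
        Finset.sum_const, Int.card_Icc, nsmul_eq_mul, add_sub_cancel_right]
      congr 1
      exact_mod_cast Int.toNat_of_nonneg h.le
  have h1 : upperRG v hv t = ⊤ :=
    htop _ (csInf_le (bddBelow_le_herbrandPhi v hv t) (hphi t le_rfl).ge)
  intro u hu
  have h2 : upperRG v hv u = ⊥ := by
    refine hbot _ (lt_of_not_ge fun hle => ?_)
    have := le_herbrandPhi_sInf v hv u
    rw [hphi _ hle] at this
    have : u ≤ sInf {n : ℤ | (u : ℚ) ≤ herbrandPhi v hv n} := by exact_mod_cast this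
    omega
  rw [h1, h2]
  exact bot_ne_top
end herbrand

section coset
variable {p : ℕ} [Fact p.Prime] {G : Type*} [Group G] [Fintype G]

lemma card_fiber_mul (χ : G →* Multiplicative (ZMod p)) (A : Subgroup G) (hA : ¬ A ≤ χ.ker)
    (c : Multiplicative (ZMod p)) :
    p * (Finset.univ.filter fun g : G => χ g = c ∧ g ∈ A).card = Nat.card A := by
  have hp : Nat.card (Multiplicative (ZMod p)) = p := by simp
  have hmap : A.map χ = ⊤ := by
    have : Fact (Nat.card (Multiplicative (ZMod p))).Prime := by rw [hp]; infer_instance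
    refine (Subgroup.eq_bot_or_eq_top_of_prime_card (A.map χ)).resolve_left fun h => hA ?_
    exact (Subgroup.map_eq_bot_iff _).1 h
  have hsurj : ∀ d : Multiplicative (ZMod p), ∃ g ∈ A, χ g = d := fun d => by
    have : d ∈ A.map χ := hmap ▸ Subgroup.mem_top d
    exact Subgroup.mem_map.1 this
  have hconst : ∀ d : Multiplicative (ZMod p),
      (Finset.univ.filter fun g : G => χ g = d ∧ g ∈ A).card =
      (Finset.univ.filter fun g : G => χ g = c ∧ g ∈ A).card := by
    intro d
    obtain ⟨g₀, hg₀, hg₀d⟩ := hsurj (c * d⁻¹)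
    refine Finset.card_bij' (fun g _ => g₀ * g) (fun g _ => g₀⁻¹ * g) ?_ ?_ ?_ ?_
    · intro g hg
      simp only [Finset.mem_filter, Finset.mem_univ, true_and] at hg ⊢
      exact ⟨by rw [map_mul, hg₀d, hg.1, inv_mul_cancel_right], A.mul_mem hg₀ hg.2⟩
    · intro g hg
      simp only [Finset.mem_filter, Finset.mem_univ, true_and] at hg ⊢
      refine ⟨?_, A.mul_mem (A.inv_mem hg₀) hg.2⟩
      rw [map_mul, map_inv, hg₀d, hg.1]
      simp
    · simp
    · simp
  have h1 : (Finset.univ.filter fun g : G => g ∈ A).card =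
      ∑ d : Multiplicative (ZMod p), (Finset.univ.filter fun g : G => χ g = d ∧ g ∈ A).card := by
    rw [Finset.card_eq_sum_card_fiberwise (f := χ) (t := Finset.univ) (fun _ _ => by simp)]
    refine Finset.sum_congr rfl fun d _ => ?_
    rw [Finset.filter_filter]
    congr 1
    ext g
    simp [and_comm]
  rw [Finset.sum_congr rfl fun d _ => hconst d, Finset.sum_const, Finset.card_univ,
    ← Nat.card_eq_fintype_card, hp, smul_eq_mul] at h1
  rw [← h1, Nat.card_eq_fintype_card, Fintype.card_subtype]

lemma sum_fiber_mul (χ : G →* Multiplicative (ZMod p)) (a : G → ℤ) (A : ℤ → Subgroup G) (J : ℤ)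
    (c : Multiplicative (ZMod p))
    (ha : ∀ g, χ g = c → 0 ≤ a g ∧ a g ≤ J + 1 ∧ ∀ i, g ∈ A i ↔ i + 1 ≤ a g)
    (hJ : ∀ i ≤ J, ¬ A i ≤ χ.ker) :
    (p : ℤ) * ∑ g with χ g = c, a g = ∑ i ∈ Finset.Icc 0 J, (Nat.card (A i) : ℤ) := by
  have h1 : ∀ g, χ g = c → a g = ∑ i ∈ Finset.Icc 0 J, if g ∈ A i then 1 else 0 := by
    intro g hg
    obtain ⟨h0, hJ, hi⟩ := ha g hg
    rw [Finset.sum_boole]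
    have : (Finset.Icc 0 J).filter (fun i => g ∈ A i) = Finset.Icc 0 (a g - 1) := by
      ext i
      rw [Finset.mem_filter, Finset.mem_Icc, Finset.mem_Icc, hi]
      omega
    rw [this, Int.card_Icc]
    omega
  rw [Finset.sum_congr rfl fun g hg => h1 g (Finset.mem_filter.1 hg).2, Finset.sum_comm,
    Finset.mul_sum]
  refine Finset.sum_congr rfl fun i hi => ?_
  rw [← card_fiber_mul χ (A i) (hJ i (Finset.mem_Icc.1 hi).2) c, Finset.sum_boole,
    Finset.filter_filter]
  push_cast
  rfl
end coset

/-- A homomorphism to `ℤ/p` trivial on a subgroup and nontrivial on an element outside of it. -/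
lemma exists_character {p h : ℕ} [Fact p.Prime] {G : Type*} [Group G]
    (e : G ≃* (Fin h → Multiplicative (ZMod p))) (A : Subgroup G) {g : G} (hg : g ∉ A) :
    ∃ χ : G →* Multiplicative (ZMod p), A ≤ χ.ker ∧ χ g ≠ 1 := by
  let e' : G ≃* Multiplicative (Fin h → ZMod p) := e.trans
    { toFun := fun f => Multiplicative.ofAdd fun i => (f i).toAdd
      invFun := fun f i => Multiplicative.ofAdd (f.toAdd i)
      left_inv := fun _ => rfl
      right_inv := fun _ => rfl
      map_mul' := fun _ _ => rfl }
  let S : Submodule (ZMod p) (Fin h → ZMod p) :=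
    AddSubgroup.toZModSubmodule p (Subgroup.toAddSubgroup' (A.map e'.toMonoidHom))
  have hS : ∀ x : Fin h → ZMod p, x ∈ S ↔ Multiplicative.ofAdd x ∈ A.map e'.toMonoidHom :=
    fun _ => Iff.rfl
  have hgS : (Multiplicative.toAdd (e' g) : Fin h → ZMod p) ∉ S := by
    rw [hS]
    rintro ⟨a, ha, hae⟩
    exact hg (e'.injective hae ▸ ha)
  obtain ⟨f, hf, hfS⟩ := Submodule.exists_le_ker_of_notMem hgS
  let f' : (Fin h → ZMod p) →+ ZMod p := f.toAddMonoidHom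
  refine ⟨(AddMonoidHom.toMultiplicative f').comp e'.toMonoidHom, fun a ha => ?_,
    fun h1 => hf ?_⟩
  · have : (Multiplicative.toAdd (e' a) : Fin h → ZMod p) ∈ S := (hS _).2 ⟨a, ha, rfl⟩
    have h0 : f (Multiplicative.toAdd (e' a)) = 0 := hfS this
    exact congrArg Multiplicative.ofAdd h0
  · exact congrArg Multiplicative.toAdd h1

section polynomial

open Polynomial

lemma IsDenseGenerator.val_sub_le {F : Type*} [Field F] {v : AddValuation F (WithTop ℤ)} {x : F}
    (hx : IsDenseGenerator v x) (σ : F →+* F) (hσ : ∀ z, v (σ z) = v z) {c : F} (hc : 0 ≤ v c) :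
    v (σ x - x) ≤ v (σ c - c) := by
  refine le_of_forall_min_le 0 fun N => ?_
  obtain ⟨g, hg⟩ := hx.2 c hc N
  have h1 : σ c - c = (σ (c - aeval x g) - (c - aeval x g)) + (aeval (σ x) g - aeval x g) := by
    have : σ (aeval x g) = aeval (σ x) g := by
      rw [aeval_def, aeval_def, hom_eval₂]
      congr 1
      exact RingHom.ext_int _ _
    rw [map_sub, this]
    ring
  rw [h1, Nat.cast_zero, sub_zero]
  refine v.map_le_add ((min_le_left _ _).trans (v.map_le_sub ?_ hg)) ((min_le_right _ _).trans ?_)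
  · rw [hσ]; exact hg
  · let x₁ : intRing v := ⟨x, hx.1⟩
    let x₂ : intRing v := ⟨σ x, by rw [mem_intRing, hσ]; exact hx.1⟩
    have hev : ∀ z : intRing v,
        (((g.map (Int.castRingHom (intRing v))).eval z : intRing v) : F) = aeval (z : F) g := by
      intro z
      rw [eval_map, show ((eval₂ (Int.castRingHom _) z g : intRing v) : F) =
        (intRing v).subtype (eval₂ (Int.castRingHom _) z g) from rfl, hom_eval₂, aeval_def]
      congr 1
    obtain ⟨k, hk⟩ := (g.map (Int.castRingHom (intRing v))).sub_dvd_eval_sub x₂ x₁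
    have h2 := congrArg (Subtype.val : intRing v → F) hk
    push_cast at h2
    rw [hev, hev] at h2
    rw [show aeval (σ x) g - aeval x g = (σ x - x) * (k : F) from h2, v.map_mul]
    exact le_add_of_nonneg_right k.2

lemma IsDenseGenerator.eq_id {F : Type*} [Field F] {v : AddValuation F (WithTop ℤ)} {x : F}
    (hx : IsDenseGenerator v x) (σ : F →+* F) (hσ : ∀ z, v (σ z) = v z) (hσx : σ x = x) (c : F) :
    σ c = c := by
  have key : ∀ c, 0 ≤ v c → σ c = c := by
    intro c hc
    have := hx.val_sub_le σ hσ hc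
    rw [hσx, sub_self, v.map_zero, top_le_iff, v.top_iff] at this
    exact sub_eq_zero.1 this
  rcases (intRing v).mem_or_inv_mem c with h | h
  · exact key c h
  · have := key _ h
    rw [map_inv₀] at this
    exact inv_injective this

lemma IsDenseGenerator.mem_lowerRG {K F : Type*} [Field K] [Field F] [Algebra K F]
    {v : AddValuation F (WithTop ℤ)} (hv : GalInvariant K v) {x : F} (hx : IsDenseGenerator v x)
    (σ : F ≃ₐ[K] F) (i : ℤ) :
    σ ∈ lowerRG v hv i ↔ ((i + 1 : ℤ) : WithTop ℤ) ≤ v (σ x - x) :=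
  ⟨fun h => h x hx.1, fun h _ hc => h.trans (hx.val_sub_le (σ : F →+* F) (hv σ) hc)⟩

lemma nsmul_le_nsmul_iff_withTop {e : ℕ} (he : 0 < e) {a b : WithTop ℤ} :
    e • a ≤ e • b ↔ a ≤ b := by
  refine ⟨fun h => ?_, fun h => nsmul_le_nsmul_right h e⟩
  induction b using WithTop.recTopCoe with
  | top => exact le_top
  | coe b =>
    induction a using WithTop.recTopCoe with
    | top =>
      obtain ⟨n, rfl⟩ := Nat.exists_eq_succ_of_ne_zero he.ne'
      rw [succ_nsmul, WithTop.add_top, top_le_iff] at h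
      have h1 : (((n.succ • b : ℤ)) : WithTop ℤ) = ⊤ := h
      exact absurd h1 (WithTop.coe_ne_top)
    | coe a =>
      have h1 : ((e • a : ℤ) : WithTop ℤ) ≤ ((e • b : ℤ) : WithTop ℤ) := h
      have h2 := WithTop.coe_le_coe.1 h1
      rw [nsmul_eq_mul, nsmul_eq_mul] at h2
      exact WithTop.coe_le_coe.2 (le_of_mul_le_mul_left h2 (by exact_mod_cast he))

lemma nsmul_inj_withTop {e : ℕ} (he : 0 < e) {a b : WithTop ℤ} : e • a = e • b ↔ a = b := by
  rw [le_antisymm_iff, le_antisymm_iff, nsmul_le_nsmul_iff_withTop he,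
    nsmul_le_nsmul_iff_withTop he]

/-- A discrete valuation restricts, up to normalization, to any subfield on which it is
nontrivial. -/
lemma exists_extends {L M : Type*} [Field L] [Field M] [Algebra L M]
    (vM : AddValuation M (WithTop ℤ)) {a : L} {n : ℤ} (hn : n ≠ 0)
    (ha : vM (algebraMap L M a) = n) :
    ∃ (vL : AddValuation L (WithTop ℤ)) (e : ℕ), IsNormalized vL ∧ Extends vL vM e := by
  let S : AddSubgroup ℤ :=
    { carrier := {m | ∃ x : L, vM (algebraMap L M x) = m}
      zero_mem' := ⟨1, by rw [map_one, vM.map_one]; rfl⟩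
      add_mem' := by
        rintro b c ⟨x, hx⟩ ⟨y, hy⟩
        exact ⟨x * y, by rw [map_mul, vM.map_mul, hx, hy]; rfl⟩
      neg_mem' := by
        rintro b ⟨x, hx⟩
        exact ⟨x⁻¹, by rw [map_inv₀, vM.map_inv, hx]; rfl⟩ }
  obtain ⟨e₀, he₀⟩ := Int.subgroup_cyclic S
  have hS : ∀ m : ℤ, m ∈ S ↔ (e₀.natAbs : ℤ) ∣ m := by
    intro m
    rw [he₀, ← AddSubgroup.zmultiples_eq_closure, Int.mem_zmultiples_iff, Int.natAbs_dvd]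
  have he : 0 < e₀.natAbs := by
    refine Int.natAbs_pos.2 fun h0 => hn ?_
    have : n ∈ S := ⟨a, ha⟩
    rw [hS, h0] at this
    simpa using this
  set e := e₀.natAbs
  have hex : ∀ x : L, ∃ c : WithTop ℤ, vM (algebraMap L M x) = e • c := by
    intro x
    by_cases hx : x = 0
    · refine ⟨⊤, ?_⟩
      rw [hx, map_zero, vM.map_zero]
      obtain ⟨n, hn⟩ := Nat.exists_eq_succ_of_ne_zero he.ne'
      rw [hn, succ_nsmul, WithTop.add_top]
    · have hx' : algebraMap L M x ≠ 0 := by simpa using hx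
      obtain ⟨m, hm⟩ := WithTop.ne_top_iff_exists.1 (vM.ne_top_iff.2 hx')
      obtain ⟨k, hk⟩ := (hS m).1 ⟨x, hm.symm⟩
      refine ⟨k, ?_⟩
      rw [← hm, hk, ← nsmul_eq_mul]
      rfl
  choose f hf using hex
  have heq : ∀ {b c : WithTop ℤ}, e • b = e • c → b = c := (nsmul_inj_withTop he).1
  let vL : AddValuation L (WithTop ℤ) := AddValuation.of f
    (heq (by
      rw [← hf, map_zero, vM.map_zero]
      obtain ⟨n, hn⟩ := Nat.exists_eq_succ_of_ne_zero he.ne'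
      rw [hn, succ_nsmul, WithTop.add_top]))
    (heq (by rw [← hf, map_one, vM.map_one, nsmul_zero]))
    (fun x y => (nsmul_le_nsmul_iff_withTop he).1 (by
      rw [← hf, map_add]
      refine le_trans ?_ (vM.map_add _ _)
      rw [hf, hf]
      exact le_min (nsmul_le_nsmul_right (min_le_left _ _) e)
        (nsmul_le_nsmul_right (min_le_right _ _) e)))
    (fun x y => heq (by rw [← hf, map_mul, vM.map_mul, hf, hf, nsmul_add]))
  refine ⟨vL, e, fun m => ?_, he, hf⟩
  obtain ⟨x, hx⟩ := (hS (e * m)).2 (dvd_mul_right _ _)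
  refine ⟨x, heq ?_⟩
  rw [show vL x = f x from rfl, ← hf, hx, ← nsmul_eq_mul]
  rfl

lemma Extends.of_tower {K L M : Type*} [Field K] [Field L] [Field M] [Algebra K L] [Algebra L M]
    [Algebra K M] [IsScalarTower K L M] {vK : AddValuation K (WithTop ℤ)}
    {vL : AddValuation L (WithTop ℤ)} {vM : AddValuation M (WithTop ℤ)} {eM e : ℕ}
    (hK : IsNormalized vK) (hKM : Extends vK vM eM) (hLM : Extends vL vM e) :
    ∃ eL, Extends vK vL eL := by
  have htower : ∀ x : K, e • vL (algebraMap K L x) = eM • vK x := fun x => by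
    rw [← hLM.2, ← hKM.2, ← IsScalarTower.algebraMap_apply]
  obtain ⟨π, hπ⟩ := hK 1
  have hπ0 : algebraMap K L π ≠ 0 := by simpa using ne_zero_of_val_eq_coe vK hπ
  obtain ⟨n, hn⟩ := WithTop.ne_top_iff_exists.1 (vL.ne_top_iff.2 hπ0)
  have h1 := htower π
  rw [← hn, hπ] at h1
  have h2 : (e : ℤ) * n = eM := by
    have h3 : ((e • n : ℤ) : WithTop ℤ) = ((eM • (1 : ℤ) : ℤ) : WithTop ℤ) := h1
    have := WithTop.coe_inj.1 h3
    simpa using this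
  have hn0 : 0 < n := by
    have : (0 : ℤ) < e * n := by rw [h2]; exact_mod_cast hKM.1
    exact pos_of_mul_pos_right this (by positivity)
  refine ⟨n.toNat, by omega, fun x => (nsmul_inj_withTop hLM.1).1 ?_⟩
  rw [htower, ← mul_nsmul']
  congr 1
  zify
  rw [Int.toNat_of_nonneg hn0.le, h2]

lemma GalInvariant.of_extends {K L M : Type*} [Field K] [Field L] [Field M] [Algebra K L]
    [Algebra L M] [Algebra K M] [IsScalarTower K L M] [Normal K M]
    {vL : AddValuation L (WithTop ℤ)} {vM : AddValuation M (WithTop ℤ)} {e : ℕ}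
    (hM : GalInvariant K vM) (hLM : Extends vL vM e) : GalInvariant K vL := fun σ x =>
  (nsmul_inj_withTop hLM.1).1 (by
    rw [← hLM.2, ← hLM.2, ← AlgEquiv.liftNormal_commutes σ M, hM])

lemma finite_residueField_of_extends (p : ℕ) [Fact p.Prime] {K M : Type*} [Field K]
    [Algebra ℚ_[p] K] [FiniteDimensional ℚ_[p] K] [Field M] [Algebra K M] [FiniteDimensional K M]
    {vK : AddValuation K (WithTop ℤ)} {eK : ℕ} (hK : IsPadicValuation p vK eK)
    {vM : AddValuation M (WithTop ℤ)} {e : ℕ} (hext : Extends vK vM e) :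
    Finite (IsLocalRing.ResidueField (intRing vM)) := by
  let _ : Algebra ℚ_[p] M := ((algebraMap K M).comp (algebraMap ℚ_[p] K)).toAlgebra
  have : IsScalarTower ℚ_[p] K M := IsScalarTower.of_algebraMap_eq fun _ => rfl
  have : FiniteDimensional ℚ_[p] M := FiniteDimensional.trans _ K M
  refine finite_residueField p vM (e * eK) (Nat.mul_pos hext.1 hK.2.1) fun x hx => ?_
  rw [IsScalarTower.algebraMap_apply ℚ_[p] K M, hext.2, hK.2.2 x hx, Nat.cast_mul, mul_assoc,
    ← nsmul_eq_mul]
  rfl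

end polynomial

lemma galInvariant_intermediateField {K M : Type*} [Field K] [Field M] [Algebra K M]
    (vM : AddValuation M (WithTop ℤ)) (hM : GalInvariant K vM) (L : IntermediateField K M) :
    GalInvariant L vM :=
  fun σ => hM (σ.restrictScalars K)

section fixedField
variable {p : ℕ} [Fact p.Prime] {K M : Type*} [Field K] [Field M] [Algebra K M]
  [FiniteDimensional K M] (χ : (M ≃ₐ[K] M) →* Multiplicative (ZMod p))

lemma finrank_fixedField_ker [IsGalois K M] {g : M ≃ₐ[K] M} (hg : χ g ≠ 1) :
    Module.finrank K (IntermediateField.fixedField χ.ker) = p := by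
  have hp : Nat.card (Multiplicative (ZMod p)) = p := by simp
  have : Fact (Nat.card (Multiplicative (ZMod p))).Prime := by rw [hp]; infer_instance
  have hrange : χ.range = ⊤ :=
    (Subgroup.eq_bot_or_eq_top_of_prime_card χ.range).resolve_left fun h => hg <| by
      have : χ g ∈ χ.range := ⟨g, rfl⟩
      rwa [h, Subgroup.mem_bot] at this
  rw [IntermediateField.finrank_eq_fixingSubgroup_index,
    IntermediateField.fixingSubgroup_fixedField, Subgroup.index_ker, hrange, Subgroup.card_top, hp]

variable (vM : AddValuation M (WithTop ℤ)) (hM : GalInvariant K vM)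

/-- The inertia group relative to an intermediate field is the trace of the inertia group. -/
lemma card_lowerRG_fixedField_ker :
    Nat.card (lowerRG vM (galInvariant_intermediateField vM hM
      (IntermediateField.fixedField χ.ker)) 0) =
    (Finset.univ.filter fun g : M ≃ₐ[K] M => χ g = 1 ∧ g ∈ lowerRG vM hM 0).card := by
  rw [← Fintype.card_subtype, ← Nat.card_eq_fintype_card]
  refine Nat.card_congr (Equiv.ofBijective
    (fun σ => ⟨σ.1.restrictScalars K, ?_, fun x hx => σ.2 x hx⟩) ⟨?_, ?_⟩)
  · have : σ.1.restrictScalars K ∈ (IntermediateField.fixedField χ.ker).fixingSubgroup := by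
      rw [IntermediateField.mem_fixingSubgroup_iff]
      exact fun x hx => σ.1.commutes ⟨x, hx⟩
    rwa [IntermediateField.fixingSubgroup_fixedField, MonoidHom.mem_ker] at this
  · intro σ τ h
    apply Subtype.ext
    ext x
    exact congrArg (fun g : {g : M ≃ₐ[K] M // χ g = 1 ∧ g ∈ lowerRG vM hM 0} => g.1 x) h
  · rintro ⟨g, hg, hg0⟩
    let σ : M ≃ₐ[IntermediateField.fixedField χ.ker] M :=
      AlgEquiv.ofRingEquiv (f := (g : M ≃+* M)) fun x => x.2 ⟨g, hg⟩
    exact ⟨⟨σ, fun x hx => hg0 x hx⟩, rfl⟩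

/-- The ramification number of the restriction of `g` to the fixed field of the kernel of a
character `χ`, in terms of the Herbrand function at the last index `J` at which `χ` is nontrivial
on the lower ramification group. -/
theorem val_restrictNormal_sub [IsGalois K M] {L : IntermediateField K M}
    (hLχ : L = IntermediateField.fixedField χ.ker) [IsGalois K L] (hMn : IsNormalized vM)
    (vL : AddValuation L (WithTop ℤ)) (hLn : IsNormalized vL)
    (e : ℕ) (hext : Extends vL vM e) (hL : GalInvariant K vL)
    [Finite (IsLocalRing.ResidueField (intRing vL))]
    {x : M} (hx : IsDenseGenerator vM x)
    {y : L} (hy : IsDenseGenerator vL y)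
    {J : ℤ} (hJ₁ : -1 ≤ J) (hJ₂ : ∀ i, i ≤ J ↔ ¬ lowerRG vM hM i ≤ χ.ker)
    {g : M ≃ₐ[K] M} (hg : χ g ≠ 1) :
    ∃ w : ℤ, vL (g.restrictNormal L y - y) = w ∧
      (w : ℚ) = herbrandPhi vM hM J + 1 := by
  have hvx : ∀ σ : M ≃ₐ[K] M, χ σ ≠ 1 → vM (σ x - x) ≠ ⊤ := by
    intro σ hσ h
    refine hσ ?_
    have h1 : σ = 1 := by
      ext c
      exact hx.eq_id (σ : M →+* M) (hM σ) (sub_eq_zero.1 (vM.top_iff.1 h)) c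
    rw [h1, map_one]
  choose! a ha using fun σ hσ => WithTop.ne_top_iff_exists.1 (hvx σ hσ)
  have hfix : ∀ z : L, algebraMap L M (g.restrictNormal L z) = g (algebraMap L M z) :=
    fun z => g.restrictNormal_commutes L z
  have hval : ∀ z : L, e • vL (g.restrictNormal L z - z) =
      vM (g (algebraMap L M z) - algebraMap L M z) := by
    intro z
    rw [← hext.2, map_sub, hfix]
  have hsum := val_smul_sub_eq_sum vM (G := M ≃ₐ[K] M) hM χ.ker hx
    (y := algebraMap L M y) (by
      intro h h' hh
      have h1 : ((h' : M ≃ₐ[K] M)⁻¹ * h) x = x := by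
        rw [AlgEquiv.mul_apply, show (h : M ≃ₐ[K] M) x = (h' : M ≃ₐ[K] M) x from hh]
        exact (h' : M ≃ₐ[K] M).symm_apply_apply x
      have h2 : (h' : M ≃ₐ[K] M)⁻¹ * h = 1 := by
        ext c
        exact hx.eq_id (((h' : M ≃ₐ[K] M)⁻¹ * h : M ≃ₐ[K] M) : M →+* M) (hM _) h1 c
      exact Subtype.ext (inv_mul_eq_one.1 h2).symm)
    ((hext.val_nonneg_iff y).2 hy.1) (fun h => (hLχ ▸ y.2 : (y : M) ∈ IntermediateField.fixedField χ.ker) h) g (by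
      intro c hc hcH
      have hcL : c ∈ L := hLχ ▸ fun h => hcH h
      have h1 := hval ⟨c, hcL⟩
      have h2 := hval y
      refine (h2.symm.le.trans ?_).trans h1.le
      refine nsmul_le_nsmul_right (hy.val_sub_le
        ((g.restrictNormal L : L ≃ₐ[K] L) : L →+* L) (hL _) ?_) e
      exact (hext.val_nonneg_iff _).1 hc)
  have hreindex : ∑ h : χ.ker, vM (g • h • x - x) =
      ((∑ σ with χ σ = χ g, a σ : ℤ) : WithTop ℤ) := by
    rw [WithTop.coe_sum]
    refine Finset.sum_bij' (fun h _ => g * h) (fun σ hσ => ⟨g⁻¹ * σ, ?_⟩) ?_ ?_ ?_ ?_ ?_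
    · rw [MonoidHom.mem_ker, map_mul, (Finset.mem_filter.1 hσ).2, map_inv, inv_mul_cancel]
    · intro h _
      refine Finset.mem_filter.2 ⟨Finset.mem_univ _, ?_⟩
      rw [map_mul, MonoidHom.mem_ker.1 h.2, mul_one]
    · exact fun _ _ => Finset.mem_univ _
    · exact fun h _ => Subtype.ext (inv_mul_cancel_left _ _)
    · exact fun σ _ => mul_inv_cancel_left _ _
    · intro h _
      rw [ha]
      · rfl
      · rwa [map_mul, MonoidHom.mem_ker.1 h.2, mul_one]
  have hmem : ∀ σ, χ σ ≠ 1 → ∀ i, σ ∈ lowerRG vM hM i ↔ i + 1 ≤ a σ := by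
    intro σ hσ i
    rw [hx.mem_lowerRG hM, ← ha σ hσ, WithTop.coe_le_coe]
  have hcount := sum_fiber_mul χ a (lowerRG vM hM) J (χ g) (fun σ hσ => by
    have hσ1 : χ σ ≠ 1 := hσ ▸ hg
    refine ⟨?_, ?_, hmem σ hσ1⟩
    · have := (hmem σ hσ1 (-1)).1 (lowerRG_neg_one vM hM ▸ Subgroup.mem_top σ)
      omega
    · by_contra! hlt
      have h1 := (hmem σ hσ1 (J + 1)).2 (by omega)
      have h2 := (not_congr (hJ₂ (J + 1))).1 (by omega)
      exact hσ1 (MonoidHom.mem_ker.1 (not_not.1 h2 h1)))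
    (fun i hi => (hJ₂ i).1 hi)
  have hw := (hval y).trans (hsum.trans hreindex)
  obtain ⟨w, hw'⟩ : ∃ w : ℤ, (w : WithTop ℤ) = vL (g.restrictNormal L y - y) := by
    refine WithTop.ne_top_iff_exists.1 fun h => ?_
    rw [h] at hw
    obtain ⟨n, hn⟩ := Nat.exists_eq_succ_of_ne_zero hext.1.ne'
    rw [hn, succ_nsmul, WithTop.add_top] at hw
    exact WithTop.top_ne_coe hw
  refine ⟨w, hw'.symm, ?_⟩
  have hew : (e : ℤ) * w = ∑ σ with χ σ = χ g, a σ := by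
    rw [← hw'] at hw
    have h1 : ((e • w : ℤ) : WithTop ℤ) = ((∑ σ with χ σ = χ g, a σ : ℤ) : WithTop ℤ) := hw
    simpa using WithTop.coe_inj.1 h1
  rw [← hew] at hcount
  have hp0 : 0 < p := (Fact.out : p.Prime).pos
  rcases hJ₁.eq_or_lt with rfl | hJ
  · have : w = 0 := by
      have h1 : (p : ℤ) * (e * w) = 0 := by simpa using hcount
      have := hext.1
      simpa [hp0.ne', this.ne'] using h1
    rw [this, herbrandPhi_of_nonpos vM hM (by norm_num)]
    norm_num
  · have hJ0 : 0 ≤ J := by omega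
    have hcard : p * e = Nat.card (lowerRG vM hM 0) := by
      subst hLχ
      rw [← card_fiber_mul χ (lowerRG vM hM 0) ((hJ₂ 0).1 hJ0) 1,
        ← card_lowerRG_fixedField_ker χ vM hM, card_lowerRG_zero vL vM hLn hMn e hext]
    have hcardQ : (p : ℚ) * e = Nat.card (lowerRG vM hM 0) := by exact_mod_cast hcard
    have h0 : (Nat.card (lowerRG vM hM 0) : ℚ) ≠ 0 := by
      exact_mod_cast (card_lowerRG_pos vM hM 0).ne'
    have hIcc : Finset.Icc (0 : ℤ) J = insert 0 (Finset.Icc 1 J) := by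
      ext i; simp only [Finset.mem_Icc, Finset.mem_insert]; omega
    rw [hIcc, Finset.sum_insert (by simp)] at hcount
    have hcountQ : (p : ℚ) * (e * w) = Nat.card (lowerRG vM hM 0) +
        ∑ i ∈ Finset.Icc (1 : ℤ) J, (Nat.card (lowerRG vM hM i) : ℚ) := by exact_mod_cast hcount
    rw [← mul_assoc, hcardQ] at hcountQ
    rw [herbrandPhi_of_nonneg vM hM hJ0, div_add_one h0, eq_div_iff h0, mul_comm, hcountQ, add_comm]
end fixedField

/-- Proposition 7, converse direction. If `M/K` is Galois with group
`(ℤ/pℤ)^h` and `t` is an upper ramification jump of `M/K`, then there is an intermediate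
field `L` with `[L : K] = p` whose upper ramification jump equals `t`. -/
theorem statement_9
    (p : ℕ) [Fact p.Prime]
    (K : Type*) [Field K] [Algebra ℚ_[p] K] [FiniteDimensional ℚ_[p] K]
    (vK : AddValuation K (WithTop ℤ)) (eK : ℕ)
    (hvK : IsPadicValuation p vK eK)
    (M : Type*) [Field M] [Algebra K M] [FiniteDimensional K M] [IsGalois K M]
    (h : ℕ) (helem : Nonempty ((M ≃ₐ[K] M) ≃* (Fin h → Multiplicative (ZMod p))))
    (vM : AddValuation M (WithTop ℤ)) (eM : ℕ)
    (hvM : IsNormalized vM) (hextM : Extends vK vM eM) (hGalM : GalInvariant K vM)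
    (t : ℤ) (ht : IsUpperJump vM hGalM t) :
    ∃ L : IntermediateField K M, Module.finrank K ↥L = p ∧
      ∃ (vL : AddValuation ↥L (WithTop ℤ)) (hGalL : GalInvariant K vL) (eL eML : ℕ),
        IsNormalized vL ∧ Extends vK vL eL ∧ Extends vL vM eML ∧
        IsUpperJump vL hGalL t := by
  obtain ⟨iso⟩ := helem
  obtain ⟨g₀, hg₀t, hg₀⟩ : ∃ g ∈ upperRG vM hGalM t, g ∉ upperRG vM hGalM (t + 1) := by
    by_contra! hle
    exact ht (t + 1) (by omega) (le_antisymm (upperRG_antitone vM hGalM (by omega)) hle)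
  obtain ⟨χ, hχ, hχg₀⟩ := exists_character iso (upperRG vM hGalM (t + 1)) hg₀
  have hfin := finrank_fixedField_ker χ hχg₀
  have : χ.ker.Normal := inferInstance
  have : IsGalois K (IntermediateField.fixedField χ.ker) :=
    IsGalois.of_fixedField_normal_subgroup χ.ker
  obtain ⟨π, hπ⟩ := hvK.1 1
  obtain ⟨vL, e, hLn, hext⟩ := exists_extends (L := IntermediateField.fixedField χ.ker) vM
    (a := algebraMap K _ π) (n := eM) (by exact_mod_cast hextM.1.ne') (by
      rw [← IsScalarTower.algebraMap_apply, hextM.2, hπ, ← nsmul_one (eM : ℕ)]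
      rfl)
  obtain ⟨eL, hextL⟩ := Extends.of_tower hvK.1 hextM hext
  have hL : GalInvariant K vL := hGalM.of_extends hext
  refine ⟨IntermediateField.fixedField χ.ker, hfin, vL, hL, eL, e, hLn, hextL, hext, ?_⟩
  have := finite_residueField_of_extends p hvK hextM
  have := finite_residueField_of_extends p hvK hextL
  obtain ⟨x, hx⟩ := exists_isDenseGenerator vM hvM
  obtain ⟨y, hy⟩ := exists_isDenseGenerator vL hLn
  obtain ⟨J, hJ, hJmax⟩ := Int.exists_greatest_of_bdd
    (P := fun i => ¬ lowerRG vM hGalM i ≤ χ.ker)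
    ⟨sInf {n : ℤ | ((t + 1 : ℤ) : ℚ) ≤ herbrandPhi vM hGalM n}, fun i hi => by
      by_contra! hlt
      exact hi ((lowerRG_antitone vM hGalM hlt.le).trans hχ)⟩
    ⟨_, fun hle => hχg₀ (MonoidHom.mem_ker.1 (hle hg₀t))⟩
  have hJ₁ : -1 ≤ J := hJmax _ fun hle => hχg₀ <| MonoidHom.mem_ker.1 <|
    hle (lowerRG_neg_one vM hGalM ▸ Subgroup.mem_top g₀)
  have hJ₂ : ∀ i, i ≤ J ↔ ¬ lowerRG vM hGalM i ≤ χ.ker := fun i =>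
    ⟨fun hi hle => hJ ((lowerRG_antitone vM hGalM hi).trans hle), hJmax i⟩
  have ht₁ : (t : ℚ) ≤ herbrandPhi vM hGalM J :=
    (le_herbrandPhi_sInf vM hGalM t).trans <| herbrandPhi_monotone vM hGalM <|
      hJmax _ fun hle => hχg₀ (MonoidHom.mem_ker.1 (hle hg₀t))
  have ht₂ : herbrandPhi vM hGalM J < ((t + 1 : ℤ) : ℚ) := by
    by_contra! hle
    exact hJ ((lowerRG_antitone vM hGalM
      (csInf_le (bddBelow_le_herbrandPhi vM hGalM (t + 1)) hle)).trans hχ)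
  have hval : ∀ s : IntermediateField.fixedField χ.ker ≃ₐ[K] IntermediateField.fixedField χ.ker,
      s ≠ 1 → vL (s y - y) = ((t + 1 : ℤ) : WithTop ℤ) := by
    intro s hs
    obtain ⟨g, hg⟩ := AlgEquiv.restrictNormalHom_surjective (F := K)
      (K₁ := IntermediateField.fixedField χ.ker) M s
    have hχg : χ g ≠ 1 := by
      intro h1
      refine hs ?_
      ext z
      rw [← hg]
      exact (g.restrictNormal_commutes _ z).trans (z.2 ⟨g, h1⟩)
    obtain ⟨w, hw, hwJ⟩ := val_restrictNormal_sub χ vM hGalM rfl hvM vL hLn e hext hL hx hy hJ₁ hJ₂ hχg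
    have hw₁ : t + 1 ≤ w := by
      have : ((t + 1 : ℤ) : ℚ) ≤ w := by rw [hwJ]; push_cast; linarith
      exact_mod_cast this
    have hw₂ : w < t + 2 := by
      have : (w : ℚ) < ((t + 2 : ℤ) : ℚ) := by
        rw [hwJ]; push_cast at ht₂ ⊢; linarith
      exact_mod_cast this
    obtain rfl : w = t + 1 := by omega
    rw [← hg]
    exact hw
  have hcard := IsGalois.card_aut_eq_finrank K (IntermediateField.fixedField χ.ker)
  rw [hfin] at hcard
  have : Nontrivial (IntermediateField.fixedField χ.ker ≃ₐ[K] IntermediateField.fixedField χ.ker) :=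
    Finite.one_lt_card_iff_nontrivial.1 (by rw [hcard]; exact (Fact.out : p.Prime).one_lt)
  refine isUpperJump_of_lowerRG vL hL (fun i hi => ?_) (fun i hi => ?_)
  · refine eq_top_iff.2 fun s _ => ?_
    by_cases hs : s = 1
    · exact hs ▸ one_mem _
    · rw [hy.mem_lowerRG hL, hval s hs]
      exact WithTop.coe_le_coe.2 (by omega)
  · refine eq_bot_iff.2 fun s hs => ?_
    by_contra hs1
    rw [hy.mem_lowerRG hL, hval s hs1] at hs
    have := WithTop.coe_le_coe.1 hs
    omega

end PaperRam
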